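/- arXiv:math/0409017 — 3 statements merged into one kernel-verified Lean document; each statement's English description precedes it below -/
import Mathlib

section
/- Let n ≥ 1. If f ∈ L¹(ℝⁿ) satisfies Mf = f almost everywhere, then f = 0 almost everywhere. In other words, the maximal operator M has no nonzero fixed points in L¹(ℝⁿ), in any dimension. -/
open MeasureTheory Metric ENNReal

/-- The centered Hardy–Littlewood maximal operator on `ℝⁿ`, with values in `ℝ≥0∞`. -/
noncomputable def centeredMaximal {n : ℕ} (f : EuclideanSpace ℝ (Fin n) → ℝ)
    (x : EuclideanSpace ℝ (Fin n)) : ℝ≥0∞ :=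
  ⨆ (r : ℝ) (_ : 0 < r),
    (∫⁻ y in ball x r, ENNReal.ofReal |f y| ∂volume) / volume (ball x r)

open Set Filter Topology

/-- Integrating over all centers `x` the integral of `g` over `ball x r` multiplies the integral
of `g` by the volume of a ball of radius `r`. -/
theorem lintegral_setLIntegral_ball {n : ℕ} {g : EuclideanSpace ℝ (Fin n) → ℝ≥0∞}
    (hg : AEMeasurable g volume) (r : ℝ) :
    ∫⁻ x, ∫⁻ y in ball x r, g y = (∫⁻ y, g y) * volume (ball (0 : EuclideanSpace ℝ (Fin n)) r) := by
  have hS : MeasurableSet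
      {p : EuclideanSpace ℝ (Fin n) × EuclideanSpace ℝ (Fin n) | dist p.2 p.1 < r} :=
    measurableSet_lt (by fun_prop) measurable_const
  calc ∫⁻ x, ∫⁻ y in ball x r, g y
      = ∫⁻ x, ∫⁻ y, (ball x r).indicator g y := by
        simp_rw [lintegral_indicator measurableSet_ball]
    _ = ∫⁻ y, ∫⁻ x, (ball x r).indicator g y := by
        refine lintegral_lintegral_swap ?_
        exact (hg.comp_snd (μ := volume)).indicator hS
    _ = ∫⁻ y, ∫⁻ x, (ball y r).indicator (fun _ => g y) x := by
        refine lintegral_congr fun y => lintegral_congr fun x => ?_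
        simp only [indicator, mem_ball, dist_comm]
    _ = ∫⁻ y, g y * volume (ball (0 : EuclideanSpace ℝ (Fin n)) r) := by
        refine lintegral_congr fun y => ?_
        rw [lintegral_indicator measurableSet_ball, setLIntegral_const,
          Measure.addHaar_ball_center]
    _ = _ := lintegral_mul_const'' _ hg

theorem tendsto_volume_ball_nat {n : ℕ} (hn : 1 ≤ n) :
    Tendsto (fun k : ℕ => volume (ball (0 : EuclideanSpace ℝ (Fin n)) k)) atTop (𝓝 ⊤) := by
  have : Nonempty (Fin n) := ⟨⟨0, hn⟩⟩
  have h := tendsto_measure_iUnion_atTop (μ := volume)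
    (s := fun k : ℕ => ball (0 : EuclideanSpace ℝ (Fin n)) k)
    fun i j hij => ball_subset_ball (by exact_mod_cast hij)
  rwa [iUnion_ball_nat, measure_univ_of_isAddLeftInvariant] at h

theorem setLIntegral_ball_le_of_centeredMaximal_le {n : ℕ} {f : EuclideanSpace ℝ (Fin n) → ℝ}
    {x : EuclideanSpace ℝ (Fin n)} {c : ℝ≥0∞} (h : centeredMaximal f x ≤ c) {r : ℝ} (hr : 0 < r) :
    ∫⁻ y in ball x r, ENNReal.ofReal |f y| ≤
      c * volume (ball (0 : EuclideanSpace ℝ (Fin n)) r) := by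
  have h' : (∫⁻ y in ball x r, ENNReal.ofReal |f y|) / volume (ball x r) ≤ c :=
    (le_iSup₂ (f := fun (r : ℝ) (_ : 0 < r) =>
      (∫⁻ y in ball x r, ENNReal.ofReal |f y| ∂volume) / volume (ball x r)) r hr).trans h
  rw [← Measure.addHaar_ball_center volume x r]
  exact (ENNReal.div_le_iff (measure_ball_pos _ _ hr).ne' measure_ball_lt_top.ne).1 h'

theorem statement4 (n : ℕ) (hn : 1 ≤ n) (f : EuclideanSpace ℝ (Fin n) → ℝ)
    (hf : Integrable f volume)
    (hfix : ∀ᵐ x ∂(volume : Measure (EuclideanSpace ℝ (Fin n))),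
      centeredMaximal f x = ENNReal.ofReal (f x)) :
    f =ᵐ[volume] (fun _ => (0 : ℝ)) := by
  set g : EuclideanSpace ℝ (Fin n) → ℝ≥0∞ := fun x => ENNReal.ofReal |f x| with hg_def
  have hg : AEMeasurable g volume := hf.abs.aestronglyMeasurable.aemeasurable.ennreal_ofReal
  have hg_fin : ∫⁻ y, g y ≠ ⊤ := hf.abs.lintegral_lt_top.ne
  -- The ball averages are dominated by `g` and have the same integral, hence agree with `g`.
  have h_eq : ∀ k : ℕ, 0 < k → (fun x => ∫⁻ y in ball x k, g y) =ᵐ[volume]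
      fun x => g x * volume (ball (0 : EuclideanSpace ℝ (Fin n)) k) := by
    intro k hk
    have hk' : (0 : ℝ) < k := by exact_mod_cast hk
    refine ae_eq_of_ae_le_of_lintegral_le ?_ ?_ (hg.mul_const _) ?_
    · filter_upwards [hfix] with x hx
      exact setLIntegral_ball_le_of_centeredMaximal_le
        (hx.le.trans (ENNReal.ofReal_le_ofReal (le_abs_self _))) hk'
    · rw [lintegral_setLIntegral_ball hg]
      exact ENNReal.mul_ne_top hg_fin measure_ball_lt_top.ne
    · rw [lintegral_setLIntegral_ball hg, lintegral_mul_const'' _ hg]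
  have h_all : ∀ᵐ x ∂(volume : Measure (EuclideanSpace ℝ (Fin n))), ∀ k : ℕ, 0 < k →
      ∫⁻ y in ball x k, g y = g x * volume (ball (0 : EuclideanSpace ℝ (Fin n)) k) := by
    rw [ae_all_iff]
    intro k
    by_cases hk : 0 < k
    · filter_upwards [h_eq k hk] with x hx _ using hx
    · exact Eventually.of_forall fun x h => absurd h hk
  filter_upwards [h_all] with x hx
  by_contra hfx
  have hgx : g x ≠ 0 := by simpa [hg_def] using hfx
  have h_lim := ENNReal.Tendsto.const_mul (a := g x) (tendsto_volume_ball_nat hn)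
    (Or.inl ENNReal.top_ne_zero)
  rw [ENNReal.mul_top hgx] at h_lim
  refine hg_fin (top_le_iff.1 (le_of_tendsto h_lim ?_))
  filter_upwards [eventually_gt_atTop 0] with k hk
  rw [← hx k hk]
  exact setLIntegral_le_lintegral _ _
end

section
/- Let n = 1 or n = 2. If f : ℝⁿ → ℝ is continuous, nonnegative, and satisfies (1/|B(x,r)|)∫_{B(x,r)} f(y) dy ≤ f(x) for every x ∈ ℝⁿ and every r > 0, then f is constant. (The only positive super-harmonic functions on ℝ and ℝ² are the constants.) -/
open MeasureTheory Metric ENNReal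

/-- The barrier `log s + 1 - 1 / s` lies locally below a quadratic polynomial whose value at
`s = ‖x‖ ^ 2` is strictly super-harmonic in the plane. -/
lemma exists_quadratic_bound_log_sub_inv {s₀ : ℝ} (hs₀ : 0 < s₀) :
    ∃ δ A C : ℝ, 0 < δ ∧ 0 < C ∧ A < 2 * C * s₀ ∧ ∀ s, |s - s₀| < δ →
      Real.log s + 1 - s⁻¹ ≤
        Real.log s₀ + 1 - s₀⁻¹ + A * (s - s₀) - C * (s - s₀) ^ 2 := by
  obtain ⟨η, hη, hη'⟩ : ∃ η : ℝ, 0 < η ∧ η * (4 * (s₀ + 1)) = 1 :=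
    ⟨(4 * (s₀ + 1))⁻¹, by positivity, inv_mul_cancel₀ (by positivity)⟩
  have hη4 : η < 1 / 4 := by nlinarith [mul_pos hη hs₀]
  refine ⟨s₀ * (η / 2), (1 + s₀⁻¹) / s₀, ((1 / 2 - η) + (1 - η) * s₀⁻¹) / s₀ ^ 2, by positivity,
    ?_, ?_, ?_⟩
  · have : 0 < s₀⁻¹ := by positivity
    have h1 : 0 < (1 - η) * s₀⁻¹ := mul_pos (by linarith) this
    exact div_pos (by linarith) (by positivity)
  · have h : 2 * (((1 / 2 - η) + (1 - η) * s₀⁻¹) / s₀ ^ 2) * s₀ - (1 + s₀⁻¹) / s₀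
        = (1 - 2 * η * (s₀ + 1)) / s₀ ^ 2 := by
      field_simp
      ring
    have : 0 < (1 - 2 * η * (s₀ + 1)) / s₀ ^ 2 := div_pos (by nlinarith) (by positivity)
    linarith
  · intro s hs
    obtain ⟨u, rfl⟩ : ∃ u, s = s₀ * (1 + u) := ⟨s / s₀ - 1, by field_simp; ring⟩
    have hu : |u| < η / 2 := by
      have : s₀ * (1 + u) - s₀ = s₀ * u := by ring
      rw [this, abs_mul, abs_of_pos hs₀] at hs
      exact lt_of_mul_lt_mul_left hs hs₀.le
    obtain ⟨hu1, hu2⟩ := abs_lt.1 hu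
    have hpos : 0 < 1 + u := by linarith
    have hlog : Real.log (1 + u) ≤ u - (1 / 2 - η) * u ^ 2 := by
      have h := Real.abs_log_sub_add_sum_range_le (x := -u) (by rw [abs_neg]; linarith) 2
      simp only [Finset.sum_range_succ, Finset.sum_range_zero, abs_neg, sub_neg_eq_add] at h
      have h2 : |u| ^ (2 + 1) / (1 - |u|) ≤ η * u ^ 2 := by
        rw [div_le_iff₀ (by linarith), pow_succ, sq_abs]
        nlinarith [sq_nonneg u, mul_nonneg (sq_nonneg u) (by nlinarith : 0 ≤ η * (1 - |u|) - |u|)]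
      have h3 := (le_abs_self _).trans (h.trans h2)
      norm_num at h3
      linarith
    have hinv : 1 - u + (1 - η) * u ^ 2 ≤ (1 + u)⁻¹ := by
      rw [← one_div, le_div_iff₀ hpos]
      have : 0 ≤ u ^ 2 * (η - (1 - η) * u) := mul_nonneg (sq_nonneg u) (by nlinarith)
      linarith
    rw [Real.log_mul hs₀.ne' hpos.ne', mul_inv]
    have hs : 0 < s₀⁻¹ := by positivity
    have := mul_le_mul_of_nonneg_left hinv hs.le
    have e : (1 + s₀⁻¹) / s₀ * (s₀ * (1 + u) - s₀)
        - ((1 / 2 - η) + (1 - η) * s₀⁻¹) / s₀ ^ 2 * (s₀ * (1 + u) - s₀) ^ 2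
        = (1 + s₀⁻¹) * u - ((1 / 2 - η) + (1 - η) * s₀⁻¹) * u ^ 2 := by
      field_simp
      ring
    nlinarith

lemma integrableOn_ball_of_continuous {n : ℕ} {g : EuclideanSpace ℝ (Fin n) → ℝ}
    (hg : Continuous g) (x : EuclideanSpace ℝ (Fin n)) (r : ℝ) : IntegrableOn g (ball x r) :=
  (hg.continuousOn.integrableOn_compact (isCompact_closedBall x r)).mono_set ball_subset_closedBall

lemma setIntegral_ball_zero_comp_isometry {n : ℕ} (g : EuclideanSpace ℝ (Fin n) → ℝ)
    (J : EuclideanSpace ℝ (Fin n) ≃ₗᵢ[ℝ] EuclideanSpace ℝ (Fin n)) (r : ℝ) :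
    ∫ t in ball 0 r, g (J t) = ∫ t in ball 0 r, g t := by
  have h := J.measurePreserving.setIntegral_preimage_emb
    J.toHomeomorph.measurableEmbedding g (ball 0 r)
  rw [← h, J.preimage_ball, map_zero]

lemma setIntegral_ball_zero_eq_zero_of_odd {n : ℕ} {g : EuclideanSpace ℝ (Fin n) → ℝ}
    (hg : ∀ t, g (-t) = -g t) (r : ℝ) : ∫ t in ball 0 r, g t = 0 := by
  have h := setIntegral_ball_zero_comp_isometry g (LinearIsometryEquiv.neg ℝ) r
  simp only [LinearIsometryEquiv.coe_neg, hg, integral_neg] at h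
  linarith

lemma setIntegral_ball_eq_setIntegral_ball_zero {n : ℕ} (g : EuclideanSpace ℝ (Fin n) → ℝ)
    (x : EuclideanSpace ℝ (Fin n)) (r : ℝ) :
    ∫ y in ball x r, g y = ∫ t in ball 0 r, g (x + t) := by
  have h := (measurePreserving_add_left volume x).setIntegral_preimage_emb
    (MeasurableEquiv.addLeft x).measurableEmbedding g (ball x r)
  rw [← h]
  simp

lemma norm_sq_mul_integral_le_two_mul_integral_inner_sq {n : ℕ} (hn : n = 1 ∨ n = 2)
    (x : EuclideanSpace ℝ (Fin n)) (r : ℝ) :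
    ‖x‖ ^ 2 * ∫ t in ball (0 : EuclideanSpace ℝ (Fin n)) r, ‖t‖ ^ 2 ≤
      2 * ∫ t in ball (0 : EuclideanSpace ℝ (Fin n)) r, inner ℝ x t ^ 2 := by
  rw [← integral_const_mul]
  rcases hn with rfl | rfl
  · have h : ∀ t : EuclideanSpace ℝ (Fin 1), ‖x‖ ^ 2 * ‖t‖ ^ 2 = inner ℝ x t ^ 2 := by
      intro t
      simp [EuclideanSpace.norm_sq_eq, PiLp.inner_apply, mul_pow, mul_comm]
    simp only [h]
    have : 0 ≤ ∫ t in ball (0 : EuclideanSpace ℝ (Fin 1)) r, inner ℝ x t ^ 2 :=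
      integral_nonneg fun t => sq_nonneg _
    linarith
  · have : Fact (Module.finrank ℝ (EuclideanSpace ℝ (Fin 2)) = 2) := ⟨by simp⟩
    let o : Orientation ℝ (EuclideanSpace ℝ (Fin 2)) (Fin 2) :=
      (EuclideanSpace.basisFun (Fin 2) ℝ).toBasis.orientation
    have h : ∀ t : EuclideanSpace ℝ (Fin 2), ‖x‖ ^ 2 * ‖t‖ ^ 2 =
        inner ℝ x t ^ 2 + inner ℝ x (o.rightAngleRotation t) ^ 2 := by
      intro t
      rw [← o.inner_sq_add_areaForm_sq, o.inner_rightAngleRotation_right, neg_sq]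
    simp only [h]
    rw [integral_add (integrableOn_ball_of_continuous (by fun_prop) _ _)
      (integrableOn_ball_of_continuous (by fun_prop) _ _),
      setIntegral_ball_zero_comp_isometry (fun t => inner ℝ x t ^ 2) o.rightAngleRotation, two_mul]

lemma setIntegral_ball_norm_sq_pos {n : ℕ} (hn : n ≠ 0) {r : ℝ} (hr : 0 < r) :
    0 < ∫ t in ball (0 : EuclideanSpace ℝ (Fin n)) r, ‖t‖ ^ 2 := by
  have : NeZero n := ⟨hn⟩
  rw [setIntegral_pos_iff_support_of_nonneg_ae (Filter.Eventually.of_forall fun t => by positivity)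
    (integrableOn_ball_of_continuous (by fun_prop) _ _)]
  have : Function.support (fun t : EuclideanSpace ℝ (Fin n) => ‖t‖ ^ 2) = {0}ᶜ := by
    ext t
    simp
  rw [this, Set.inter_comm, ← Set.sdiff_eq, measure_sdiff_null (by simp)]
  exact measure_ball_pos _ _ hr

lemma setIntegral_quadratic_norm_sq_pos {n : ℕ} (hn : n = 1 ∨ n = 2)
    (x : EuclideanSpace ℝ (Fin n)) {r A C : ℝ} (hr : 0 < r) (hC : 0 < C)
    (hA : A < 2 * C * ‖x‖ ^ 2) :
    0 < ∫ y in ball x r, (C * (‖y‖ ^ 2 - ‖x‖ ^ 2) ^ 2 - A * (‖y‖ ^ 2 - ‖x‖ ^ 2)) := by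
  have hI {g : EuclideanSpace ℝ (Fin n) → ℝ} (hg : Continuous g) : IntegrableOn g (ball 0 r) :=
    integrableOn_ball_of_continuous hg 0 r
  rw [setIntegral_ball_eq_setIntegral_ball_zero]
  have h : ∀ t : EuclideanSpace ℝ (Fin n),
      C * (‖x + t‖ ^ 2 - ‖x‖ ^ 2) ^ 2 - A * (‖x + t‖ ^ 2 - ‖x‖ ^ 2) =
      (4 * C * inner ℝ x t ^ 2 - A * ‖t‖ ^ 2) + C * ‖t‖ ^ 4 +
        inner ℝ x t * (4 * C * ‖t‖ ^ 2 - 2 * A) := by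
    intro t
    rw [norm_add_sq_real]
    ring
  simp only [h]
  rw [integral_add (hI (by fun_prop)) (hI (by fun_prop)),
    integral_add (hI (by fun_prop)) (hI (by fun_prop)),
    integral_sub (hI (by fun_prop)) (hI (by fun_prop)), integral_const_mul, integral_const_mul,
    setIntegral_ball_zero_eq_zero_of_odd
      (g := fun t => inner ℝ x t * (4 * C * ‖t‖ ^ 2 - 2 * A)) (by intro t; simp)]
  have h4 : 0 ≤ ∫ t in ball (0 : EuclideanSpace ℝ (Fin n)) r, C * ‖t‖ ^ 4 :=
    integral_nonneg fun t => by positivity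
  have h2 := setIntegral_ball_norm_sq_pos (n := n) (by omega) hr
  have h3 := mul_le_mul_of_nonneg_left
    (norm_sq_mul_integral_le_two_mul_integral_inner_sq hn x r) hC.le
  have h5 := mul_pos (sub_pos.2 hA) h2
  linarith

/-- The set-integral form of the super-mean-value inequality. -/
lemma setIntegral_sub_nonpos_of_setAverage_le {n : ℕ} {f : EuclideanSpace ℝ (Fin n) → ℝ}
    (hcont : Continuous f) {x : EuclideanSpace ℝ (Fin n)} {r : ℝ} (hr : 0 < r)
    (h : ⨍ y in ball x r, f y ≤ f x) : ∫ y in ball x r, (f y - f x) ≤ 0 := by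
  have hv : 0 < volume.real (ball x r) :=
    ENNReal.toReal_pos (measure_ball_pos _ _ hr).ne' measure_ball_lt_top.ne
  rw [setAverage_eq, smul_eq_mul, inv_mul_le_iff₀ hv] at h
  rw [integral_sub (integrableOn_ball_of_continuous hcont _ _)
    (integrableOn_ball_of_continuous continuous_const _ _), setIntegral_const, smul_eq_mul]
  linarith

/-- Comparison with the barrier: outside the unit ball `f` is at least any lower bound of `f` on
the unit sphere, up to a multiple of the barrier. -/
lemma le_add_mul_barrier {n : ℕ} (hn : n = 1 ∨ n = 2)
    {f : EuclideanSpace ℝ (Fin n) → ℝ} (hcont : Continuous f) (hf0 : ∀ x, 0 ≤ f x)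
    (hsh : ∀ (x : EuclideanSpace ℝ (Fin n)) (r : ℝ), 0 < r → ⨍ y in ball x r, f y ≤ f x)
    {m : ℝ} (hm : ∀ x, ‖x‖ = 1 → m ≤ f x) {ε : ℝ} (hε : 0 < ε)
    {y : EuclideanSpace ℝ (Fin n)} (hy : 1 ≤ ‖y‖) :
    m ≤ f y + ε * (Real.log (‖y‖ ^ 2) + 1 - (‖y‖ ^ 2)⁻¹) := by
  set h : EuclideanSpace ℝ (Fin n) → ℝ := fun x => Real.log (‖x‖ ^ 2) + 1 - (‖x‖ ^ 2)⁻¹ with hh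
  change m ≤ f y + ε * h y
  by_contra! hlt
  obtain ⟨R, hRy, hR⟩ : ∃ R, ‖y‖ < R ∧ ∀ x : EuclideanSpace ℝ (Fin n), ‖x‖ = R → m ≤ ε * h x := by
    refine ⟨max (‖y‖ + 1) (Real.exp (m / ε)), by simp, fun x hx => ?_⟩
    have hx1 : 1 ≤ ‖x‖ := by rw [hx]; exact le_max_of_le_left (by linarith)
    have hx2 : m / ε ≤ Real.log ‖x‖ := by
      rw [Real.le_log_iff_exp_le (by linarith), hx]
      exact le_max_right _ _
    have hx3 : (‖x‖ ^ 2)⁻¹ ≤ 1 := inv_le_one_of_one_le₀ (one_le_pow₀ hx1)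
    have hx4 := Real.log_nonneg hx1
    rw [← div_le_iff₀' hε]
    simp only [hh, Real.log_pow]
    push_cast
    linarith
  set K : Set (EuclideanSpace ℝ (Fin n)) := closedBall 0 R ∩ {x | 1 ≤ ‖x‖}
  have hK : IsCompact K :=
    (isCompact_closedBall 0 R).inter_right (isClosed_le continuous_const continuous_norm)
  have hhK : ContinuousOn (fun x => f x + ε * h x) K := by
    have h0 : ∀ x ∈ K, ‖x‖ ^ 2 ≠ 0 := fun x hx => by
      have : 1 ≤ ‖x‖ := hx.2
      positivity
    have hc : ContinuousOn (fun x : EuclideanSpace ℝ (Fin n) => ‖x‖ ^ 2) K := by fun_prop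
    exact hcont.continuousOn.add (continuousOn_const.mul
      (((hc.log h0).add continuousOn_const).sub (hc.inv₀ h0)))
  obtain ⟨x₀, hx₀K, hx₀⟩ := hK.exists_isMinOn ⟨y, by simpa using hRy.le, hy⟩ hhK
  have hx₀m : f x₀ + ε * h x₀ < m := (hx₀ ⟨by simpa using hRy.le, hy⟩).trans_lt hlt
  have hx₀1 : 1 < ‖x₀‖ := by
    refine lt_of_le_of_ne hx₀K.2 fun he => ?_
    have := hm x₀ he.symm
    simp only [hh, ← he] at hx₀m
    norm_num at hx₀m
    linarith
  have hx₀R : ‖x₀‖ < R := by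
    refine lt_of_le_of_ne (by simpa using hx₀K.1) fun he => ?_
    have := hR x₀ he
    have := hf0 x₀
    linarith
  obtain ⟨δ, A, C, hδ, hC, hA, hb⟩ :=
    exists_quadratic_bound_log_sub_inv (s₀ := ‖x₀‖ ^ 2) (by positivity)
  have hU : {x : EuclideanSpace ℝ (Fin n) | 1 < ‖x‖ ∧ ‖x‖ < R ∧ |‖x‖ ^ 2 - ‖x₀‖ ^ 2| < δ}
      ∈ nhds x₀ := by
    refine IsOpen.mem_nhds ?_ ⟨hx₀1, hx₀R, by simpa using hδ⟩
    exact (isOpen_lt continuous_const continuous_norm).inter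
      ((isOpen_lt continuous_norm continuous_const).inter
        (isOpen_lt ((continuous_norm.pow 2).sub continuous_const).abs continuous_const))
  obtain ⟨r, hr, hrU⟩ := Metric.mem_nhds_iff.1 hU
  have hpos := setIntegral_quadratic_norm_sq_pos hn x₀ hr hC hA
  have hle := setIntegral_sub_nonpos_of_setAverage_le hcont hr (hsh x₀ r hr)
  have hmono : ∫ x in ball x₀ r,
      ε * (C * (‖x‖ ^ 2 - ‖x₀‖ ^ 2) ^ 2 - A * (‖x‖ ^ 2 - ‖x₀‖ ^ 2)) ≤
      ∫ x in ball x₀ r, (f x - f x₀) := by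
    refine setIntegral_mono_on (integrableOn_ball_of_continuous (by fun_prop) _ _)
      (integrableOn_ball_of_continuous (by fun_prop) _ _) measurableSet_ball fun x hx => ?_
    obtain ⟨h1, h2, h3⟩ := hrU hx
    have hmin : f x₀ + ε * h x₀ ≤ f x + ε * h x := hx₀ ⟨by simpa using h2.le, h1.le⟩
    have := mul_le_mul_of_nonneg_left (hb _ h3) hε.le
    simp only [hh] at hmin
    linarith
  rw [integral_const_mul] at hmono
  have := mul_pos hε hpos
  linarith

/-- Strong minimum principle: a continuous super-harmonic function attaining its minimum is
constant. -/
lemma eq_of_forall_le_of_setAverage_le {n : ℕ} {f : EuclideanSpace ℝ (Fin n) → ℝ}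
    (hcont : Continuous f)
    (hsh : ∀ (x : EuclideanSpace ℝ (Fin n)) (r : ℝ), 0 < r → ⨍ y in ball x r, f y ≤ f x)
    {x₁ : EuclideanSpace ℝ (Fin n)} (hmin : ∀ x, f x₁ ≤ f x) (y : EuclideanSpace ℝ (Fin n)) :
    f y = f x₁ := by
  have hr : 0 < dist y x₁ + 1 := by positivity
  have hle := setIntegral_sub_nonpos_of_setAverage_le hcont hr (hsh x₁ _ hr)
  have h0 : 0 ≤ fun x => f x - f x₁ := fun x => sub_nonneg.2 (hmin x)
  have hae := (integral_eq_zero_iff_of_nonneg h0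
    (integrableOn_ball_of_continuous (by fun_prop) _ _)).1 (hle.antisymm (integral_nonneg h0))
  have hy := Measure.eqOn_open_of_ae_eq hae isOpen_ball (by fun_prop) continuousOn_const
    (mem_ball.2 (lt_add_one (dist y x₁)))
  exact sub_eq_zero.1 hy

theorem statement7 (n : ℕ) (hn : n = 1 ∨ n = 2) (f : EuclideanSpace ℝ (Fin n) → ℝ)
    (hcont : Continuous f) (hf0 : ∀ x, 0 ≤ f x)
    (hsh : ∀ (x : EuclideanSpace ℝ (Fin n)) (r : ℝ), 0 < r →
      ⨍ y in ball x r, f y ≤ f x) :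
    ∃ c : ℝ, ∀ x, f x = c := by
  obtain ⟨x₁, -, hx₁⟩ := (isCompact_closedBall (0 : EuclideanSpace ℝ (Fin n)) 1).exists_isMinOn
    ⟨0, by simp⟩ hcont.continuousOn
  refine ⟨f x₁, eq_of_forall_le_of_setAverage_le hcont hsh fun y => ?_⟩
  rcases le_total ‖y‖ 1 with hy | hy
  · exact hx₁ (by simpa using hy)
  · have hlim : Filter.Tendsto
        (fun ε : ℝ => f y + ε * (Real.log (‖y‖ ^ 2) + 1 - (‖y‖ ^ 2)⁻¹))
        (nhdsWithin 0 (Set.Ioi 0)) (nhds (f y)) := by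
      refine Filter.Tendsto.mono_left (Continuous.tendsto' ?_ _ _ (by simp)) nhdsWithin_le_nhds
      fun_prop
    refine ge_of_tendsto hlim (eventually_mem_nhdsWithin.mono fun ε hε => ?_)
    exact le_add_mul_barrier hn hcont hf0 hsh (fun x hx => hx₁ (by simp [hx])) hε hy
end

section
/- Let n = 1 or n = 2 and let f ∈ L¹_loc(ℝⁿ) satisfy Mf = f almost everywhere. Then f is almost everywhere equal to a constant. -/
open MeasureTheory Metric ENNReal

open Filter Topology

lemma sum_log_lt {Q t a b : ℝ} (ht : 0 < t) (ht1 : t < 1)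
    (hab : 8 * (Q + 1) * t ≤ a ^ 2 + b ^ 2)
    (h1 : 0 < Q + 2 * t + a) (h2 : 0 < Q + 2 * t - a)
    (h3 : 0 < Q + 2 * t + b) (h4 : 0 < Q + 2 * t - b) :
    Real.log (Q + 2 * t + a) + Real.log (Q + 2 * t - a) + Real.log (Q + 2 * t + b)
      + Real.log (Q + 2 * t - b) < 4 * Real.log Q := by
  rw [← Real.log_mul h1.ne' h2.ne', ← Real.log_mul (mul_pos h1 h2).ne' h3.ne',
    ← Real.log_mul (mul_pos (mul_pos h1 h2) h3).ne' h4.ne']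
  have e4 : 4 * Real.log Q = Real.log (Q ^ 4) := by rw [Real.log_pow]; norm_num
  rw [e4]
  apply Real.log_lt_log (by positivity)
  obtain ⟨A, hA⟩ : ∃ A, A = (Q + 2 * t + a) * (Q + 2 * t - a) := ⟨_, rfl⟩
  obtain ⟨B, hB⟩ : ∃ B, B = (Q + 2 * t + b) * (Q + 2 * t - b) := ⟨_, rfl⟩
  have hA0 : 0 < A := hA ▸ mul_pos h1 h2
  have hB0 : 0 < B := hB ▸ mul_pos h3 h4
  have hsum : A + B ≤ 2 * (Q ^ 2 - 4 * t * (1 - t)) := by rw [hA, hB]; nlinarith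
  have hpos : 0 < 4 * t * (1 - t) := by have : 0 < 1 - t := by linarith
                                        positivity
  have hlt : A + B < 2 * Q ^ 2 := by linarith
  calc (Q + 2 * t + a) * (Q + 2 * t - a) * (Q + 2 * t + b) * (Q + 2 * t - b) = A * B := by
        rw [hA, hB]; ring
    _ ≤ ((A + B) / 2) ^ 2 := by nlinarith [sq_nonneg (A - B)]
    _ < (Q ^ 2) ^ 2 := by
        apply pow_lt_pow_left₀ (by linarith) (by linarith) (by norm_num)
    _ = Q ^ 4 := by ring

section Barrier

variable {E : Type*} [NormedAddCommGroup E] [InnerProductSpace ℝ E]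

lemma two_mul_normSq_add (x h : E) :
    2 * ‖x + h‖ ^ 2 - 1 = (2 * ‖x‖ ^ 2 - 1) + 2 * ‖h‖ ^ 2 + 4 * inner ℝ x h := by
  rw [norm_add_sq_real]; ring

lemma two_mul_normSq_sub (x h : E) :
    2 * ‖x - h‖ ^ 2 - 1 = (2 * ‖x‖ ^ 2 - 1) + 2 * ‖h‖ ^ 2 - 4 * inner ℝ x h := by
  rw [norm_sub_sq_real]; ring

/-- `x ↦ -log (2 ‖x‖² - 1)` is strictly subharmonic outside the unit ball. -/
lemma sum_log_normSq_lt (J : E ≃ₗᵢ[ℝ] E)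
    (hJ : ∀ x h : E, ‖x‖ ^ 2 * ‖h‖ ^ 2 ≤ inner ℝ x h ^ 2 + inner ℝ x (J h) ^ 2)
    {x h : E} (hx : 1 ≤ ‖x‖) (h0 : h ≠ 0) (h1 : ‖h‖ < 1)
    (ha : 1 ≤ ‖x + h‖) (hb : 1 ≤ ‖x - h‖) (hc : 1 ≤ ‖x + J h‖) (hd : 1 ≤ ‖x - J h‖) :
    Real.log (2 * ‖x + h‖ ^ 2 - 1) + Real.log (2 * ‖x - h‖ ^ 2 - 1)
      + Real.log (2 * ‖x + J h‖ ^ 2 - 1) + Real.log (2 * ‖x - J h‖ ^ 2 - 1)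
      < 4 * Real.log (2 * ‖x‖ ^ 2 - 1) := by
  have hh : 0 < ‖h‖ := norm_pos_iff.2 h0
  have key : ∀ y : E, 1 ≤ ‖y‖ → 0 < 2 * ‖y‖ ^ 2 - 1 := fun y hy => by nlinarith
  replace ha := key _ ha
  replace hb := key _ hb
  replace hc := key _ hc
  replace hd := key _ hd
  have := key _ hx
  rw [two_mul_normSq_add] at ha hc ⊢
  rw [two_mul_normSq_sub] at hb hd ⊢
  rw [two_mul_normSq_add, two_mul_normSq_sub]
  rw [J.norm_map] at hc hd ⊢
  refine sum_log_lt (by positivity) (by nlinarith) ?_ ha hb hc hd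
  nlinarith [hJ x h]

variable [FiniteDimensional ℝ E] [MeasurableSpace E] [BorelSpace E]

lemma setIntegral_ball_comp_isometry (G : E → ℝ) (x : E) (r : ℝ) (T : E ≃ₗᵢ[ℝ] E) :
    ∫ h in ball (0 : E) r, G (x + T h) = ∫ y in ball x r, G y := by
  have hmp : MeasurePreserving (fun h : E => x + T h) volume volume :=
    (measurePreserving_add_left volume x).comp T.measurePreserving
  have hemb : MeasurableEmbedding (fun h : E => x + T h) :=
    (measurableEmbedding_addLeft x).comp T.toMeasurableEquiv.measurableEmbedding
  rw [← hmp.setIntegral_preimage_emb hemb G]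
  congr 2
  ext h
  simp

/-- In a space where the barrier `-log (2 ‖x‖² - 1)` is subharmonic, a bounded nonnegative
superharmonic function is bounded below by its infimum over the unit ball. -/
lemma le_of_superharmonic [Nontrivial E] (J : E ≃ₗᵢ[ℝ] E)
    (hJ : ∀ x h : E, ‖x‖ ^ 2 * ‖h‖ ^ 2 ≤ inner ℝ x h ^ 2 + inner ℝ x (J h) ^ 2)
    {G : E → ℝ} {K m : ℝ} (hG : LowerSemicontinuous G) (hG0 : ∀ x, 0 ≤ G x)
    (hGK : ∀ x, G x ≤ K)
    (hmean : ∀ x r, 0 < r → ∫ y in ball x r, G y ≤ volume.real (ball x r) * G x)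
    (hm : ∀ x, ‖x‖ ≤ 1 → m ≤ G x) (y : E) : m ≤ G y := by
  by_contra! hy
  have hy1 : 1 < ‖y‖ := by
    by_contra! h
    exact absurd (hm y h) (not_le.2 hy)
  set L : E → ℝ := fun x => Real.log (2 * ‖x‖ ^ 2 - 1) with hL
  have hLy : 0 < L y := Real.log_pos (by nlinarith)
  obtain ⟨δ, hδ, hδy⟩ : ∃ δ : ℝ, 0 < δ ∧ G y + δ * L y < m :=
    ⟨(m - G y) / (2 * L y), by have : 0 < m - G y := by linarith
                               positivity, by field_simp; linarith⟩
  obtain ⟨R, hRy, hR⟩ : ∃ R : ℝ, ‖y‖ < R ∧ m ≤ δ * Real.log (2 * R ^ 2 - 1) := by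
    have ht : Tendsto (fun R : ℝ => Real.log R) atTop atTop := Real.tendsto_log_atTop
    obtain ⟨R, h1, h2⟩ := ((eventually_gt_atTop ‖y‖).and
      (ht.eventually_ge_atTop (m / δ))).exists
    refine ⟨R, h1, ?_⟩
    rw [div_le_iff₀ hδ] at h2
    have : Real.log R ≤ Real.log (2 * R ^ 2 - 1) := Real.log_le_log (by linarith) (by nlinarith)
    nlinarith
  set S : Set E := closedBall 0 R \ ball 0 1 with hS
  have hSc : IsCompact S := (isCompact_closedBall 0 R).diff isOpen_ball
  have hyS : y ∈ S := by simp [hS, hRy.le, hy1.le]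
  have hS1 : ∀ x ∈ S, 1 ≤ ‖x‖ := fun x hx => by simpa [hS] using hx.2
  have hLc : ContinuousOn L S := by
    apply ContinuousOn.log
    · fun_prop
    · intro x hx
      have := hS1 x hx
      nlinarith
  have hv : LowerSemicontinuousOn (fun x => G x + δ * L x) S :=
    (hG.lowerSemicontinuousOn S).add (hLc.const_mul δ).lowerSemicontinuousOn
  obtain ⟨z, hzS, hz⟩ := hv.exists_isMinOn ⟨y, hyS⟩ hSc
  have hzm : G z + δ * L z < m := lt_of_le_of_lt (hz hyS) hδy
  have hz1 : 1 < ‖z‖ := by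
    refine lt_of_le_of_ne (hS1 z hzS) fun h => ?_
    have h1 := hm z h.ge
    have h2 : L z = 0 := by simp [hL, ← h]; norm_num
    rw [h2] at hzm
    linarith
  have hzR : ‖z‖ < R := by
    refine lt_of_le_of_ne (by simpa [hS] using hzS.1) fun h => ?_
    have h1 := hG0 z
    have h2 : L z = Real.log (2 * R ^ 2 - 1) := by simp [hL, h]
    rw [h2] at hzm
    linarith
  obtain ⟨ρ, hρ, hρ1, hρS⟩ : ∃ ρ : ℝ, 0 < ρ ∧ ρ ≤ 1 ∧ ∀ h : E, ‖h‖ < ρ → z + h ∈ S := by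
    refine ⟨min 1 (min (‖z‖ - 1) (R - ‖z‖)), ?_, min_le_left _ _, fun h hh => ?_⟩
    · exact lt_min one_pos (lt_min (by linarith) (by linarith))
    · have h1 := lt_of_lt_of_le hh ((min_le_right _ _).trans (min_le_left _ _))
      have h2 := lt_of_lt_of_le hh ((min_le_right _ _).trans (min_le_right _ _))
      have h3 := norm_add_le z h
      have h4 := norm_sub_le (z + h) h
      rw [add_sub_cancel_right] at h4
      simp only [hS, Set.mem_sdiff, mem_closedBall, dist_zero_right, mem_ball, not_lt]
      constructor <;> linarith
  have hint : ∀ T : E ≃ₗᵢ[ℝ] E, IntegrableOn (fun h => G (z + T h)) (ball 0 ρ) := by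
    intro T
    refine Measure.integrableOn_of_bounded (M := K) measure_ball_lt_top.ne ?_ ?_
    · exact (hG.measurable.comp (by fun_prop)).aestronglyMeasurable
    · refine ae_of_all _ fun h => ?_
      rw [Real.norm_of_nonneg (hG0 _)]
      exact hGK _
  set T₁ : E ≃ₗᵢ[ℝ] E := LinearIsometryEquiv.refl ℝ E
  set T₂ : E ≃ₗᵢ[ℝ] E := LinearIsometryEquiv.neg ℝ
  set T₄ : E ≃ₗᵢ[ℝ] E := J.trans T₂
  set D : E → ℝ := fun h => G (z + T₁ h) + G (z + T₂ h) + G (z + J h) + G (z + T₄ h) - 4 * G z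
    with hD
  have hD1 : IntegrableOn (fun h => G (z + T₁ h) + G (z + T₂ h)) (ball 0 ρ) :=
    (hint T₁).add (hint T₂)
  have hD2 : IntegrableOn (fun h => G (z + T₁ h) + G (z + T₂ h) + G (z + J h)) (ball 0 ρ) :=
    hD1.add (hint J)
  have hD3 : IntegrableOn (fun h => G (z + T₁ h) + G (z + T₂ h) + G (z + J h) + G (z + T₄ h))
      (ball 0 ρ) := hD2.add (hint T₄)
  have hDc : IntegrableOn (fun _ : E => 4 * G z) (ball 0 ρ) :=
    integrableOn_const measure_ball_lt_top.ne
  have hDi : IntegrableOn D (ball 0 ρ) := hD3.sub hDc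
  have hle : ∫ h in ball 0 ρ, D h ≤ 0 := by
    rw [hD, integral_sub hD3 hDc, integral_add hD2 (hint T₄), integral_add hD1 (hint J),
      integral_add (hint T₁) (hint T₂)]
    simp only [setIntegral_ball_comp_isometry, setIntegral_const, smul_eq_mul]
    have h1 := hmean z ρ hρ
    have h2 : volume.real (ball z ρ) = volume.real (ball (0 : E) ρ) := by
      simp only [Measure.real, Measure.addHaar_ball_center]
    rw [h2] at h1
    linarith
  have hpos : ∀ h : E, ‖h‖ < ρ → h ≠ 0 → 0 < D h := by
    intro h hh h0
    have m1 := hρS h hh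
    have m2 := hρS (-h) (by rwa [norm_neg])
    have m3 := hρS (J h) (by rwa [J.norm_map])
    have m4 := hρS (-J h) (by rwa [norm_neg, J.norm_map])
    have i1 : G z + δ * L z ≤ G (z + h) + δ * L (z + h) := hz m1
    have i2 : G z + δ * L z ≤ G (z + -h) + δ * L (z + -h) := hz m2
    have i3 : G z + δ * L z ≤ G (z + J h) + δ * L (z + J h) := hz m3
    have i4 : G z + δ * L z ≤ G (z + -J h) + δ * L (z + -J h) := hz m4
    have key := sum_log_normSq_lt J hJ hz1.le h0 (by linarith) (hS1 _ m1)
      (by simpa [sub_eq_add_neg] using hS1 _ m2) (hS1 _ m3)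
      (by simpa [sub_eq_add_neg] using hS1 _ m4)
    have key' : L (z + h) + L (z + -h) + L (z + J h) + L (z + -J h) < 4 * L z := by
      simpa only [hL, sub_eq_add_neg] using key
    have hDh : D h = G (z + h) + G (z + -h) + G (z + J h) + G (z + -J h) - 4 * G z := by
      simp [hD, T₁, T₂, T₄]
    rw [hDh]
    nlinarith
  have hnonneg : 0 ≤ᵐ[volume.restrict (ball 0 ρ)] D := by
    refine ae_restrict_of_forall_mem measurableSet_ball fun h hh => ?_
    rcases eq_or_ne h 0 with rfl | h0
    · simp only [hD, map_zero, add_zero, Pi.zero_apply]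
      linarith
    · exact (hpos h (by simpa using hh) h0).le
  have hposint : 0 < ∫ h in ball 0 ρ, D h := by
    rw [setIntegral_pos_iff_support_of_nonneg_ae hnonneg hDi]
    calc 0 < volume (ball (0 : E) ρ) := measure_ball_pos _ _ hρ
      _ = volume (ball (0 : E) ρ \ {0}) := (measure_sdiff_null (measure_singleton 0)).symm
      _ ≤ volume (Function.support D ∩ ball 0 ρ) := measure_mono fun h hh =>
        ⟨(hpos h (by simpa using hh.1) hh.2).ne', hh.1⟩
  linarith

lemma lowerSemicontinuous_setLIntegral_ball (g : E → ℝ≥0∞) (r : ℝ) :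
    LowerSemicontinuous fun x : E => ∫⁻ y in ball x r, g y := by
  intro x a ha
  have hU : ball x r = ⋃ k : ℕ, ball x (r - 1 / ((k : ℝ) + 1)) := by
    ext y
    simp only [mem_ball, Set.mem_iUnion]
    refine ⟨fun h => ?_, fun ⟨k, hk⟩ => ?_⟩
    · obtain ⟨k, hk⟩ := exists_nat_one_div_lt (sub_pos.2 h)
      exact ⟨k, by linarith⟩
    · have : 0 < 1 / ((k : ℝ) + 1) := by positivity
      linarith
  have hmono : Monotone fun k : ℕ => ball x (r - 1 / ((k : ℝ) + 1)) := fun i j hij =>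
    ball_subset_ball (by have := Nat.one_div_le_one_div (α := ℝ) hij; linarith)
  have hlim : Tendsto (fun k : ℕ => ∫⁻ y in ball x (r - 1 / ((k : ℝ) + 1)), g y) atTop
      (𝓝 (∫⁻ y in ball x r, g y)) := by
    have := tendsto_measure_iUnion_atTop (μ := volume.withDensity g) hmono
    rw [← hU] at this
    simpa only [Function.comp_def, withDensity_apply _ measurableSet_ball] using this
  obtain ⟨k, hk⟩ := (hlim.eventually_const_lt ha).exists
  filter_upwards [ball_mem_nhds x (show 0 < 1 / ((k : ℝ) + 1) by positivity)] with y hy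
  refine hk.trans_le (lintegral_mono_set (ball_subset_ball' ?_))
  rw [mem_ball, dist_comm] at hy
  linarith

end Barrier

lemma lowerSemicontinuous_centeredMaximal {n : ℕ} (f : EuclideanSpace ℝ (Fin n) → ℝ) :
    LowerSemicontinuous (centeredMaximal f) := by
  refine lowerSemicontinuous_iSup fun r => lowerSemicontinuous_iSup fun hr => ?_
  simp only [Measure.addHaar_ball_center]
  have hV : (volume (ball (0 : EuclideanSpace ℝ (Fin n)) r)) ≠ 0 := (measure_ball_pos _ _ hr).ne'
  refine Continuous.comp_lowerSemicontinuous (g := fun t => t / volume (ball 0 r))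
    (ENNReal.continuous_div_const _ hV) (lowerSemicontinuous_setLIntegral_ball _ r) ?_
  exact fun a b hab => ENNReal.div_le_div_right hab _

lemma setLIntegral_ball_le_centeredMaximal {n : ℕ} (f : EuclideanSpace ℝ (Fin n) → ℝ)
    (x : EuclideanSpace ℝ (Fin n)) {r : ℝ} (hr : 0 < r) :
    ∫⁻ y in ball x r, ENNReal.ofReal |f y| ≤ centeredMaximal f x * volume (ball x r) := by
  rw [← ENNReal.div_le_iff (measure_ball_pos _ _ hr).ne' measure_ball_lt_top.ne]
  exact le_iSup₂ (f := fun (r : ℝ) (_ : 0 < r) =>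
    (∫⁻ y in ball x r, ENNReal.ofReal |f y| ∂volume) / volume (ball x r)) r hr

lemma exists_isometry_inner_sq_add_inner_sq (n : ℕ) (hn : n = 1 ∨ n = 2) :
    ∃ J : EuclideanSpace ℝ (Fin n) ≃ₗᵢ[ℝ] EuclideanSpace ℝ (Fin n),
      ∀ x h, ‖x‖ ^ 2 * ‖h‖ ^ 2 ≤ inner ℝ x h ^ 2 + inner ℝ x (J h) ^ 2 := by
  rcases hn with rfl | rfl
  · refine ⟨LinearIsometryEquiv.refl ℝ _, fun x h => ?_⟩
    simp only [EuclideanSpace.norm_sq_eq, PiLp.inner_apply, LinearIsometryEquiv.coe_refl, id,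
      Finset.univ_unique, Finset.sum_singleton, Real.norm_eq_abs, sq_abs, Real.inner_apply]
    nlinarith [sq_nonneg (x default * h default)]
  · have : Fact (Module.finrank ℝ (EuclideanSpace ℝ (Fin 2)) = 2) := ⟨by simp⟩
    let o := (EuclideanSpace.basisFun (Fin 2) ℝ).toBasis.orientation
    refine ⟨o.rightAngleRotation, fun x h => ?_⟩
    rw [o.inner_rightAngleRotation_right, neg_sq, o.inner_sq_add_areaForm_sq]

/-- A function that equals its maximal function almost everywhere has a maximal function that
attains its minimum. -/
lemma exists_forall_centeredMaximal_le (n : ℕ) (hn : n = 1 ∨ n = 2)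
    (f : EuclideanSpace ℝ (Fin n) → ℝ)
    (hfix : ∀ᵐ x ∂(volume : Measure (EuclideanSpace ℝ (Fin n))),
      centeredMaximal f x = ENNReal.ofReal (f x)) :
    ∃ x, centeredMaximal f x ≠ ∞ ∧ ∀ y, centeredMaximal f x ≤ centeredMaximal f y := by
  obtain ⟨J, hJ⟩ := exists_isometry_inner_sq_add_inner_sq n hn
  have : Nonempty (Fin n) := ⟨⟨0, by omega⟩⟩
  have hlsc := lowerSemicontinuous_centeredMaximal f
  obtain ⟨x, -, hx⟩ := (hlsc.lowerSemicontinuousOn (closedBall 0 1)).exists_isMinOn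
    ⟨0, by simp⟩ (isCompact_closedBall (0 : EuclideanSpace ℝ (Fin n)) 1)
  have hfin : centeredMaximal f x ≠ ∞ := by
    obtain ⟨w, hw, hwf⟩ := Measure.exists_mem_of_measure_ne_zero_of_ae
      (measure_ball_pos volume (0 : EuclideanSpace ℝ (Fin n)) one_pos).ne' (ae_restrict_of_ae hfix)
    have : centeredMaximal f x ≤ centeredMaximal f w := hx (ball_subset_closedBall hw)
    rw [hwf] at this
    exact (this.trans_lt ENNReal.ofReal_lt_top).ne
  refine ⟨x, hfin, ?_⟩
  set F := centeredMaximal f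
  set m := F x
  have hFm : ∀ y, min (F y) m ≠ ∞ := fun y => ((min_le_right _ _).trans_lt hfin.lt_top).ne
  have hcont : Continuous fun t : ℝ≥0∞ => (min t m).toReal :=
    ENNReal.continuousOn_toReal.comp_continuous (by fun_prop)
      fun t => ((min_le_right _ _).trans_lt hfin.lt_top).ne
  have hmonot : Monotone fun t : ℝ≥0∞ => (min t m).toReal := fun a b hab =>
    ENNReal.toReal_mono ((min_le_right _ _).trans_lt hfin.lt_top).ne (min_le_min_right _ hab)
  have key := le_of_superharmonic J hJ (G := fun y => (min (F y) m).toReal) (K := m.toReal)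
    (m := m.toReal) (hcont.comp_lowerSemicontinuous hlsc hmonot)
    (fun _ => ENNReal.toReal_nonneg) (fun y => ENNReal.toReal_mono hfin (min_le_right _ _)) ?_ ?_
  · intro y
    exact ((ENNReal.toReal_le_toReal hfin (hFm y)).1 (key y)).trans (min_le_left _ _)
  · intro y r hr
    have hV : volume (ball y r) ≠ ∞ := measure_ball_lt_top.ne
    rw [integral_toReal (by exact (hlsc.measurable.min measurable_const).aemeasurable)
      (ae_of_all _ fun z => (hFm z).lt_top), Measure.real, ← ENNReal.toReal_mul]
    refine ENNReal.toReal_mono (ENNReal.mul_ne_top hV (hFm y)) ?_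
    rw [mul_comm]
    rcases le_total (F y) m with h | h
    · rw [min_eq_left h]
      calc ∫⁻ z in ball y r, min (F z) m ≤ ∫⁻ z in ball y r, ENNReal.ofReal |f z| := by
            refine lintegral_mono_ae ?_
            filter_upwards [ae_restrict_of_ae hfix] with z hz
            refine (min_le_left _ _).trans ?_
            rw [hz]
            exact ENNReal.ofReal_le_ofReal (le_abs_self _)
        _ ≤ _ := setLIntegral_ball_le_centeredMaximal f y hr
    · rw [min_eq_right h]
      calc ∫⁻ z in ball y r, min (F z) m ≤ ∫⁻ z in ball y r, m :=
            lintegral_mono fun z => min_le_right _ _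
        _ = _ := by simp
  · intro y hy
    exact ENNReal.toReal_mono (hFm y) (le_min (hx (by simpa using hy)) le_rfl)

theorem statement8 (n : ℕ) (hn : n = 1 ∨ n = 2) (f : EuclideanSpace ℝ (Fin n) → ℝ)
    (hf : LocallyIntegrable f volume)
    (hfix : ∀ᵐ x ∂(volume : Measure (EuclideanSpace ℝ (Fin n))),
      centeredMaximal f x = ENNReal.ofReal (f x)) :
    ∃ c : ℝ, f =ᵐ[volume] fun _ => c := by
  obtain ⟨x, hfin, hx⟩ := exists_forall_centeredMaximal_le n hn f hfix
  set m := centeredMaximal f x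
  have hball : ∀ k : ℕ, ∀ᵐ y ∂(volume.restrict (ball x ((k : ℝ) + 1))),
      m = ENNReal.ofReal |f y| := by
    intro k
    refine ae_eq_of_ae_le_of_lintegral_le (f := fun _ => m) ?_ ?_ ?_ ?_
    · filter_upwards [ae_restrict_of_ae hfix] with y hy
      exact ((hx y).trans hy.le).trans (ENNReal.ofReal_le_ofReal (le_abs_self _))
    · simpa using ENNReal.mul_ne_top hfin measure_ball_lt_top.ne
    · exact hf.aestronglyMeasurable.aemeasurable.abs.ennreal_ofReal.restrict
    · simpa using setLIntegral_ball_le_centeredMaximal f x (r := (k : ℝ) + 1) (by positivity)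
  have hall : ∀ᵐ y ∂(volume : Measure (EuclideanSpace ℝ (Fin n))), m = ENNReal.ofReal |f y| := by
    have hU : ⋃ k : ℕ, ball x ((k : ℝ) + 1) = Set.univ := by
      refine Set.eq_univ_of_forall fun y => Set.mem_iUnion.2 ?_
      obtain ⟨k, hk⟩ := exists_nat_gt (dist y x)
      exact ⟨k, by rw [mem_ball]; linarith⟩
    rw [← Measure.restrict_univ (μ := volume), ← hU, ae_restrict_iUnion_iff]
    exact hball
  refine ⟨m.toReal, ?_⟩
  filter_upwards [hall, hfix] with y h1 h2
  have h3 : m ≤ ENNReal.ofReal (f y) := (hx y).trans h2.le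
  rw [h1] at h3 ⊢
  rw [ENNReal.toReal_ofReal (abs_nonneg _)]
  by_cases h0 : 0 ≤ f y
  · exact (abs_of_nonneg h0).symm
  · rw [ENNReal.ofReal_of_nonpos (not_le.1 h0).le, nonpos_iff_eq_zero,
      ENNReal.ofReal_eq_zero] at h3
    have := abs_nonpos_iff.1 h3
    simp [this]
end
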